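/- Consider the one-dimensional problem a·u − (K(x)(φ(u))')' = 0 on an interval (α, β), with K continuous and K ≥ k_min > 0, a ≥ 0, and φ strictly increasing and C¹. If u₁ and u₂ are two classical solutions with u₁(α) ≤ u₂(α) and u₁(β) ≤ u₂(β), then u₁ ≤ u₂ on [α, β] (comparison principle). -/

import Mathlib

open Set

/-- Comparison principle for the 1D problem `a u − (K (φ(u))')' = 0` on `(α, β)`:
ordered boundary data implies ordered solutions. -/
theorem comparison_principle_1d (α β : ℝ) (hαβ : α < β)
    (K : ℝ → ℝ) (hKcont : Continuous K) (kmin : ℝ) (hkmin : 0 < kmin)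
    (hK : ∀ x, kmin ≤ K x)
    (a : ℝ) (ha : 0 ≤ a)
    (φ : ℝ → ℝ) (hφmono : StrictMono φ) (hφ : ContDiff ℝ 1 φ)
    (u₁ u₂ : ℝ → ℝ)
    (hu₁c : ContinuousOn u₁ (Icc α β)) (hu₂c : ContinuousOn u₂ (Icc α β))
    (hu₁d : ∀ x ∈ Ioo α β, DifferentiableAt ℝ u₁ x)
    (hu₂d : ∀ x ∈ Ioo α β, DifferentiableAt ℝ u₂ x)
    (hflux₁ : ∀ x ∈ Ioo α β,
      DifferentiableAt ℝ (fun y => K y * deriv (fun z => φ (u₁ z)) y) x)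
    (hflux₂ : ∀ x ∈ Ioo α β,
      DifferentiableAt ℝ (fun y => K y * deriv (fun z => φ (u₂ z)) y) x)
    (hpde₁ : ∀ x ∈ Ioo α β,
      a * u₁ x - deriv (fun y => K y * deriv (fun z => φ (u₁ z)) y) x = 0)
    (hpde₂ : ∀ x ∈ Ioo α β,
      a * u₂ x - deriv (fun y => K y * deriv (fun z => φ (u₂ z)) y) x = 0)
    (hbcα : u₁ α ≤ u₂ α) (hbcβ : u₁ β ≤ u₂ β) :
    ∀ x ∈ Icc α β, u₁ x ≤ u₂ x := by
  have hφd : Differentiable ℝ φ := hφ.differentiable one_ne_zero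
  have hd₁ : ∀ x ∈ Ioo α β, DifferentiableAt ℝ (fun z => φ (u₁ z)) x := fun x hx =>
    (hφd _).comp x (hu₁d x hx)
  have hd₂ : ∀ x ∈ Ioo α β, DifferentiableAt ℝ (fun z => φ (u₂ z)) x := fun x hx =>
    (hφd _).comp x (hu₂d x hx)
  set w : ℝ → ℝ := fun x => φ (u₁ x) - φ (u₂ x) with hw
  set p : ℝ → ℝ := fun y => K y * deriv (fun z => φ (u₁ z)) y -
    K y * deriv (fun z => φ (u₂ z)) y with hp
  have hwc : ContinuousOn w (Icc α β) :=
    (hφ.continuous.comp_continuousOn hu₁c).sub (hφ.continuous.comp_continuousOn hu₂c)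
  have hwpos : ∀ x, 0 < w x ↔ u₂ x < u₁ x := fun x => by
    simp only [hw, sub_pos, hφmono.lt_iff_lt]
  have hw' : ∀ x ∈ Ioo α β, HasDerivAt w
      (deriv (fun z => φ (u₁ z)) x - deriv (fun z => φ (u₂ z)) x) x := fun x hx =>
    (hd₁ x hx).hasDerivAt.sub (hd₂ x hx).hasDerivAt
  have hp' : ∀ x ∈ Ioo α β, HasDerivAt p (a * (u₁ x - u₂ x)) x := fun x hx => by
    have h := (hflux₁ x hx).hasDerivAt.sub (hflux₂ x hx).hasDerivAt
    rw [← sub_eq_zero.mp (hpde₁ x hx), ← sub_eq_zero.mp (hpde₂ x hx), ← mul_sub] at h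
    exact h
  have hpw : ∀ x ∈ Ioo α β, p x = K x * deriv w x := fun x hx => by
    rw [(hw' x hx).deriv, mul_sub]
  by_contra! hneg
  obtain ⟨x₀, hx₀, hlt⟩ := hneg
  obtain ⟨c, hc, hmax⟩ := isCompact_Icc.exists_isMaxOn ⟨x₀, hx₀⟩ hwc
  have hwcpos : 0 < w c := ((hwpos x₀).2 hlt).trans_le (hmax hx₀)
  have hcα : c ≠ α := by
    rintro rfl
    exact hbcα.not_gt ((hwpos _).1 hwcpos)
  have hcβ : c ≠ β := by
    rintro rfl
    exact hbcβ.not_gt ((hwpos _).1 hwcpos)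
  have hcI : c ∈ Ioo α β := ⟨hc.1.lt_of_ne' hcα, hc.2.lt_of_ne hcβ⟩
  have hpc : p c = 0 := by
    rw [hpw c hcI, (hmax.isLocalMax (Icc_mem_nhds hcI.1 hcI.2)).deriv_eq_zero, mul_zero]
  -- The first point to the right of the maximum where `w` is no longer positive.
  have hsub : Icc c β ⊆ Icc α β := Icc_subset_Icc_left hc.1
  have hS : IsCompact (Icc c β ∩ w ⁻¹' Iic 0) :=
    isCompact_Icc.of_isClosed_subset
      ((hwc.mono hsub).preimage_isClosed_of_isClosed isClosed_Icc isClosed_Iic) inter_subset_left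
  obtain ⟨e, ⟨⟨hce, heβ⟩, hwe⟩, hleast⟩ := hS.exists_isLeast
    ⟨β, ⟨hc.2, le_rfl⟩, not_lt.1 fun h => hbcβ.not_gt ((hwpos β).1 h)⟩
  have hpos : ∀ x ∈ Ico c e, 0 < w x := fun x hx => by
    by_contra! h
    exact hx.2.not_ge (hleast ⟨⟨hx.1, hx.2.le.trans heβ⟩, h⟩)
  have hI : ∀ x ∈ Ico c e, x ∈ Ioo α β := fun x hx =>
    ⟨hcI.1.trans_le hx.1, hx.2.trans_le heβ⟩
  have hpmono : MonotoneOn p (Ico c e) := by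
    refine monotoneOn_of_deriv_nonneg (convex_Ico c e)
      (fun x hx => (hp' x (hI x hx)).continuousAt.continuousWithinAt)
      (fun x hx => (hp' x (hI x (interior_subset hx))).differentiableAt.differentiableWithinAt)
      fun x hx => ?_
    have hx := interior_subset hx
    rw [(hp' x (hI x hx)).deriv]
    exact mul_nonneg ha (sub_nonneg.2 ((hwpos x).1 (hpos x hx)).le)
  have hwmono : MonotoneOn w (Icc c e) := by
    refine monotoneOn_of_deriv_nonneg (convex_Icc c e)
      (hwc.mono (Icc_subset_Icc hc.1 heβ)) ?_ ?_ <;> rw [interior_Icc]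
    · exact fun x hx =>
        (hw' x (hI x (Ioo_subset_Ico_self hx))).differentiableAt.differentiableWithinAt
    · intro x hx
      have hx := Ioo_subset_Ico_self hx
      have h := hpmono ⟨le_rfl, hx.1.trans_lt hx.2⟩ hx hx.1
      rw [hpc, hpw x (hI x hx)] at h
      exact nonneg_of_mul_nonneg_right h (hkmin.trans_le (hK x))
  exact (hwcpos.trans_le (hwmono ⟨le_rfl, hce⟩ ⟨hce, le_rfl⟩ hce)).not_ge hwe
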